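/- arXiv:0706.1098 — 6 statements merged into one kernel-verified Lean document; each statement's English description precedes it below -/
import Mathlib

section
/- Let 1 ≤ p < ∞ and let A = (a_{j,k})_{j,k≥1} be a nonnegative matrix satisfying condition (1.2). Then the ℓ_p-norm of A is determined by decreasing sequences: for every nonnegative sequence x with ∑_{k=1}^∞ x_k^p < ∞ there exists a nonnegative antitone sequence y with ∑_{k=1}^∞ y_k^p = ∑_{k=1}^∞ x_k^p and ∑_{j=1}^∞ ((Ay)_j)^p ≥ ∑_{j=1}^∞ ((Ax)_j)^p. -/
open scoped ENNReal

/-- `(Ax)_j = ∑_k a_{j,k} x_k`, taken in `[0,∞]`.  Rows and columns are indexed by `ℕ`,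
with index `i` corresponding to the paper's index `i+1`. -/
noncomputable def mulVec (A : ℕ → ℕ → ℝ) (x : ℕ → ℝ) (j : ℕ) : ℝ≥0∞ :=
  ∑' k, ENNReal.ofReal (A j k * x k)

/-- Condition (1.2): `∑_{j=1}^l ∑_{k=1}^r a_{j,k} ≥ ∑_{j∈N_l} ∑_{k∈N_r} a_{j,k}` for all
`l, r ≥ 1` and all finite index sets with `|N_l| = l`, `|N_r| = r`. -/
def Cond12 (A : ℕ → ℕ → ℝ) : Prop :=
  ∀ l r : ℕ, 1 ≤ l → 1 ≤ r → ∀ Nl Nr : Finset ℕ, Nl.card = l → Nr.card = r →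
    ∑ j ∈ Nl, ∑ k ∈ Nr, A j k ≤ ∑ j ∈ Finset.range l, ∑ k ∈ Finset.range r, A j k

theorem exists_antitone_rearrangement (x : ℕ → ℝ) (hb : ∃ B, ∀ k, x k ≤ B) :
    ∃ y : ℕ → ℝ, (∀ n, 0 ≤ y n) ∧ Antitone y ∧
      ∀ t, 0 ≤ t → ∀ n : ℕ, t < y n ↔ (n : ℕ∞) < {k | t < x k}.encard := by
  obtain ⟨B, hB⟩ := hb
  have bdd (n : ℕ) : BddAbove {s : ℝ | 0 ≤ s ∧ (n : ℕ∞) < {k | s < x k}.encard} := by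
    refine ⟨B, fun s hs => ?_⟩
    obtain ⟨k, hk⟩ := Set.encard_pos.1 (hs.2.trans_le' (zero_le))
    exact (lt_of_lt_of_le hk (hB k)).le
  have nonneg (n : ℕ) : 0 ≤ sSup {s : ℝ | 0 ≤ s ∧ (n : ℕ∞) < {k | s < x k}.encard} :=
    Real.sSup_nonneg fun s hs => hs.1
  have key : ∀ t, 0 ≤ t → ∀ n : ℕ,
      t < sSup {s : ℝ | 0 ≤ s ∧ (n : ℕ∞) < {k | s < x k}.encard} ↔
        (n : ℕ∞) < {k | t < x k}.encard := by
    intro t ht n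
    constructor
    · intro h
      obtain ⟨s, hs, hts⟩ := exists_lt_of_lt_csSup
        (Set.nonempty_iff_ne_empty.2 fun he => by simp [he] at h; linarith) h
      exact hs.2.trans_le (Set.encard_le_encard fun k hk => hts.trans hk)
    · intro h
      obtain ⟨S, hSE, hS⟩ := Set.exists_subset_encard_eq (Order.add_one_le_of_lt h)
      have hfin : S.Finite := Set.finite_of_encard_eq_coe (k := n + 1) (by simpa using hS)
      have hne : S.Nonempty := by
        rw [← Set.encard_pos, hS]; exact (zero_le).trans_lt (ENat.lt_add_one_iff (by simp) |>.2 le_rfl)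
      obtain ⟨a, haS, ha⟩ := Set.exists_min_image S x hfin hne
      obtain ⟨s, hts, hsa⟩ := exists_between (show t < x a from hSE haS)
      refine hts.trans_le (le_csSup (bdd n) ⟨ht.trans hts.le, ?_⟩)
      calc (n : ℕ∞) < n + 1 := ENat.lt_add_one_iff (by simp) |>.2 le_rfl
        _ = S.encard := hS.symm
        _ ≤ _ := Set.encard_le_encard fun k hk => hsa.trans_le (ha k hk)
  refine ⟨_, nonneg, fun n m hnm => le_of_forall_lt fun t htm => ?_, key⟩
  rcases lt_or_ge t 0 with ht | ht
  · exact ht.trans_le (nonneg n)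
  · rw [key t ht] at htm ⊢
    exact htm.trans_le' (by exact_mod_cast hnm)

theorem encard_setOf_natCast_lt (c : ℕ∞) : {n : ℕ | (n : ℕ∞) < c}.encard = c := by
  induction c with
  | top => simp
  | coe m =>
    have : {n : ℕ | (n : ℕ∞) < m} = (Finset.range m : Set ℕ) := by ext; simp
    rw [this, Set.encard_coe_eq_coe_finsetCard, Finset.card_range]

theorem rpow_add_mul_sub_le_rpow {p u v : ℝ} (hp : 1 ≤ p) (hu : 0 ≤ u) (hv : 0 ≤ v) :
    u ^ p + p * u ^ (p - 1) * (v - u) ≤ v ^ p := by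
  rcases hu.eq_or_lt with rfl | hu
  · rcases hp.eq_or_lt with rfl | hp
    · simp
    · rw [Real.zero_rpow (by linarith), Real.zero_rpow (by linarith)]
      simpa using Real.rpow_nonneg hv p
  · have h := one_add_mul_self_le_rpow_one_add (s := v / u - 1)
      (by linarith [div_nonneg hv hu.le]) hp
    rw [add_sub_cancel, Real.div_rpow hv hu.le, le_div_iff₀ (Real.rpow_pos_of_pos hu p)] at h
    refine le_trans (le_of_eq ?_) h
    rw [Real.rpow_sub_one hu.ne']
    field_simp

/-- Weak majorization implies domination of `p`-th power sums.  The extra term on the left makes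
the inductive argument (inserting the smallest element of `u`) work. -/
theorem sum_rpow_add_le_sum_rpow_of_sum_le {ι : Type*} [DecidableEq ι] {p : ℝ} (hp : 1 ≤ p)
    (u : ι → ℝ) (v : ℕ → ℝ)
    (hu : ∀ i, 0 ≤ u i) (hv : ∀ n, 0 ≤ v n) (N : Finset ι)
    (h : ∀ M ⊆ N, ∑ i ∈ M, u i ≤ ∑ n ∈ Finset.range M.card, v n) :
    ∀ m, 0 ≤ m → (∀ i ∈ N, m ≤ u i) →
      ∑ i ∈ N, u i ^ p +
          p * m ^ (p - 1) * (∑ n ∈ Finset.range N.card, v n - ∑ i ∈ N, u i) ≤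
        ∑ n ∈ Finset.range N.card, v n ^ p := by
  induction N using Finset.induction_on_min_value u with
  | empty => simp
  | insert a s has hmin ih =>
    intro m hm hmu
    have hs := ih (fun M hM => h M (hM.trans (Finset.subset_insert a s))) (u a) (hu a) hmin
    have htan := rpow_add_mul_sub_le_rpow hp (hu a) (hv s.card)
    have hD := h _ subset_rfl
    have hslope : p * m ^ (p - 1) ≤ p * u a ^ (p - 1) :=
      mul_le_mul_of_nonneg_left
        (Real.rpow_le_rpow hm (hmu a (Finset.mem_insert_self a s)) (by linarith)) (by linarith)
    have hmul := mul_le_mul_of_nonneg_right hslope (sub_nonneg.2 hD)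
    rw [Finset.card_insert_of_notMem has, Finset.sum_insert has, Finset.sum_range_succ] at hmul ⊢
    rw [Finset.sum_insert has, Finset.sum_range_succ]
    linarith

theorem ENNReal.sum_rpow_le_sum_rpow_of_sum_le {ι : Type*} [DecidableEq ι] {p : ℝ} (hp : 1 ≤ p)
    (u : ι → ℝ≥0∞) (v : ℕ → ℝ≥0∞) (N : Finset ι)
    (h : ∀ M ⊆ N, ∑ i ∈ M, u i ≤ ∑ n ∈ Finset.range M.card, v n) :
    ∑ i ∈ N, u i ^ p ≤ ∑ n ∈ Finset.range N.card, v n ^ p := by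
  have hp0 : 0 < p := by linarith
  by_cases hv : ∃ n ∈ Finset.range N.card, v n = ⊤
  · obtain ⟨n, hn, hvn⟩ := hv
    refine le_top.trans (top_le_iff.2 (ENNReal.sum_eq_top.2 ⟨n, hn, ?_⟩)).ge
    rw [hvn, ENNReal.top_rpow_of_pos hp0]
  push Not at hv
  have hu : ∀ i ∈ N, u i ≠ ⊤ := fun i hi => by
    have := h {i} (by simpa using hi)
    simp only [Finset.sum_singleton, Finset.card_singleton, Finset.range_one] at this
    exact ne_top_of_le_ne_top (hv 0 (by simpa using ⟨i, hi⟩)) this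
  have hreal := sum_rpow_add_le_sum_rpow_of_sum_le hp (fun i => (u i).toReal)
    (fun n => (v n).toReal) (fun _ => toReal_nonneg) (fun _ => toReal_nonneg) N
    (fun M hM => by
      have hvM : ∀ n ∈ Finset.range M.card, v n ≠ ⊤ := fun n hn =>
        hv n (Finset.range_mono (Finset.card_le_card hM) hn)
      rw [← ENNReal.toReal_sum fun i hi => hu i (hM hi), ← ENNReal.toReal_sum hvM]
      exact ENNReal.toReal_mono (ENNReal.sum_ne_top.2 hvM) (h M hM))
    0 le_rfl (fun _ _ => toReal_nonneg)
  have hD : 0 ≤ p * (0 : ℝ) ^ (p - 1) *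
      (∑ n ∈ Finset.range N.card, (v n).toReal - ∑ i ∈ N, (u i).toReal) := by
    refine mul_nonneg (mul_nonneg hp0.le (Real.rpow_nonneg le_rfl _)) (sub_nonneg.2 ?_)
    rw [← ENNReal.toReal_sum hu, ← ENNReal.toReal_sum hv]
    exact ENNReal.toReal_mono (ENNReal.sum_ne_top.2 hv) (h N subset_rfl)
  have hle : ∑ i ∈ N, (u i).toReal ^ p ≤ ∑ n ∈ Finset.range N.card, (v n).toReal ^ p := by
    linarith
  simp only [ENNReal.toReal_rpow] at hle
  rwa [← ENNReal.toReal_sum fun i hi => ENNReal.rpow_ne_top_of_nonneg hp0.le (hu i hi),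
    ← ENNReal.toReal_sum fun i hi => ENNReal.rpow_ne_top_of_nonneg hp0.le (hv i hi),
    ENNReal.toReal_le_toReal
      (ENNReal.sum_ne_top.2 fun i hi => ENNReal.rpow_ne_top_of_nonneg hp0.le (hu i hi))
      (ENNReal.sum_ne_top.2 fun i hi => ENNReal.rpow_ne_top_of_nonneg hp0.le (hv i hi))] at hle

open MeasureTheory in
theorem tsum_ofReal_rpow_eq_of_encard_eq {p : ℝ} (hp : 0 < p) {x y : ℕ → ℝ}
    (hx : ∀ k, 0 ≤ x k) (hy : ∀ k, 0 ≤ y k)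
    (h : ∀ t, 0 ≤ t → {k | t < y k}.encard = {k | t < x k}.encard) :
    ∑' k, ENNReal.ofReal (y k) ^ p = ∑' k, ENNReal.ofReal (x k) ^ p := by
  have layercake {z : ℕ → ℝ} (hz : ∀ k, 0 ≤ z k) : ∑' k, ENNReal.ofReal (z k) ^ p =
      ENNReal.ofReal p * ∫⁻ t in Set.Ioi (0 : ℝ),
        Measure.count {k | t < z k} * ENNReal.ofReal (t ^ (p - 1)) := by
    rw [← lintegral_rpow_eq_lintegral_meas_lt_mul Measure.count
      (Filter.Eventually.of_forall hz) (measurable_of_countable z).aemeasurable hp,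
      lintegral_count]
    exact tsum_congr fun k => ENNReal.ofReal_rpow_of_nonneg (hz k) hp.le
  rw [layercake hx, layercake hy]
  congr 1
  refine setLIntegral_congr_fun measurableSet_Ioi fun t ht => ?_
  simp only [Measure.count_apply .of_discrete, h t (le_of_lt ht)]

open MeasureTheory in
theorem sum_mulVec_eq_lintegral {A : ℕ → ℕ → ℝ} (hA : ∀ j k, 0 ≤ A j k) {z : ℕ → ℝ}
    (hz : ∀ k, 0 ≤ z k) (M : Finset ℕ) :
    ∑ j ∈ M, mulVec A z j = ∫⁻ t in Set.Ioi (0 : ℝ),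
      ∑' k, {k | t < z k}.indicator (fun k => ENNReal.ofReal (∑ j ∈ M, A j k)) k := by
  have hlc := lintegral_eq_lintegral_meas_lt
    (Measure.count.withDensity fun k => ENNReal.ofReal (∑ j ∈ M, A j k))
    (Filter.Eventually.of_forall hz) (measurable_of_countable z).aemeasurable
  rw [lintegral_withDensity_eq_lintegral_mul _ (measurable_of_countable _)
    (measurable_of_countable _), lintegral_count] at hlc
  simp only [withDensity_apply _ (MeasurableSet.of_discrete : MeasurableSet (_ : Set ℕ)),
    ← lintegral_indicator (MeasurableSet.of_discrete : MeasurableSet (_ : Set ℕ)),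
    lintegral_count] at hlc
  rw [← hlc]
  unfold mulVec
  rw [← Summable.tsum_finsetSum fun _ _ => ENNReal.summable]
  refine tsum_congr fun k => ?_
  rw [← ENNReal.ofReal_sum_of_nonneg fun j _ => mul_nonneg (hA j k) (hz k), ← Finset.sum_mul,
    ENNReal.ofReal_mul (Finset.sum_nonneg fun j _ => hA j k)]
  rfl

theorem Cond12.sum_le {A : ℕ → ℕ → ℝ} (h12 : Cond12 A) (M S : Finset ℕ) :
    ∑ k ∈ S, ∑ j ∈ M, A j k ≤
      ∑ k ∈ Finset.range S.card, ∑ j ∈ Finset.range M.card, A j k := by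
  rcases M.eq_empty_or_nonempty with rfl | hM
  · simp
  rcases S.eq_empty_or_nonempty with rfl | hS
  · simp
  rw [Finset.sum_comm, Finset.sum_comm (s := Finset.range S.card)]
  exact h12 _ _ hM.card_pos hS.card_pos M S rfl rfl

theorem Cond12.sum_mulVec_le {A : ℕ → ℕ → ℝ} (h12 : Cond12 A) (hA : ∀ j k, 0 ≤ A j k)
    {x y : ℕ → ℝ} (hx : ∀ k, 0 ≤ x k) (hy : ∀ k, 0 ≤ y k)
    (h : ∀ t, 0 ≤ t → ∀ n : ℕ, t < y n ↔ (n : ℕ∞) < {k | t < x k}.encard) (M : Finset ℕ) :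
    ∑ j ∈ M, mulVec A x j ≤ ∑ j ∈ Finset.range M.card, mulVec A y j := by
  classical
  rw [sum_mulVec_eq_lintegral hA hx, sum_mulVec_eq_lintegral hA hy]
  refine MeasureTheory.setLIntegral_mono' measurableSet_Ioi fun t ht => ?_
  refine ENNReal.summable.tsum_le_of_sum_le fun s => ?_
  set S := s.filter (· ∈ {k | t < x k}) with hS
  have hmem : ∀ n ∈ Finset.range S.card, t < y n := fun n hn => by
    rw [h t (le_of_lt ht)]
    calc (n : ℕ∞) < S.card := by exact_mod_cast Finset.mem_range.1 hn
      _ = (S : Set ℕ).encard := (Set.encard_coe_eq_coe_finsetCard S).symm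
      _ ≤ _ := Set.encard_le_encard fun k hk => (Finset.mem_filter.1 hk).2
  calc ∑ k ∈ s, {k | t < x k}.indicator (fun k => ENNReal.ofReal (∑ j ∈ M, A j k)) k
      = ∑ k ∈ S, ENNReal.ofReal (∑ j ∈ M, A j k) := by
        rw [hS, Finset.sum_filter]; rfl
    _ ≤ ∑ k ∈ Finset.range S.card, ENNReal.ofReal (∑ j ∈ Finset.range M.card, A j k) := by
        rw [← ENNReal.ofReal_sum_of_nonneg fun k _ => Finset.sum_nonneg fun j _ => hA j k,
          ← ENNReal.ofReal_sum_of_nonneg fun k _ => Finset.sum_nonneg fun j _ => hA j k]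
        exact ENNReal.ofReal_le_ofReal (h12.sum_le M S)
    _ = ∑ k ∈ Finset.range S.card, {k | t < y k}.indicator
          (fun k => ENNReal.ofReal (∑ j ∈ Finset.range M.card, A j k)) k :=
        Finset.sum_congr rfl fun k hk => by
          rw [Set.indicator_of_mem (show k ∈ {k | t < y k} from hmem k hk)]
    _ ≤ _ := ENNReal.sum_le_tsum _

/-- If a nonnegative matrix `A` satisfies condition (1.2), then its `ℓ_p`-norm
(`1 ≤ p < ∞`) is determined by decreasing sequences: for every nonnegative `x ∈ ℓ_p`
there is a nonnegative decreasing `y` with the same `ℓ_p`-sum and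
`∑_j ((Ay)_j)^p ≥ ∑_j ((Ax)_j)^p`. -/
theorem lp_norm_determined_by_decreasing_of_cond12
    (p : ℝ) (hp : 1 ≤ p)
    (A : ℕ → ℕ → ℝ) (hA : ∀ j k, 0 ≤ A j k) (h12 : Cond12 A)
    (x : ℕ → ℝ) (hx : ∀ k, 0 ≤ x k)
    (hxp : (∑' k, ENNReal.ofReal (x k) ^ p) < ⊤) :
    ∃ y : ℕ → ℝ, (∀ k, 0 ≤ y k) ∧ Antitone y ∧
      (∑' k, ENNReal.ofReal (y k) ^ p) = (∑' k, ENNReal.ofReal (x k) ^ p) ∧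
      (∑' j, (mulVec A x j) ^ p) ≤ (∑' j, (mulVec A y j) ^ p) := by
  have hp0 : 0 < p := by linarith
  have hbdd : ∃ B, ∀ k, x k ≤ B := by
    refine ⟨((∑' k, ENNReal.ofReal (x k) ^ p) ^ p⁻¹).toReal, fun k => ?_⟩
    rw [← ENNReal.ofReal_le_iff_le_toReal
      (ENNReal.rpow_ne_top_of_nonneg (inv_nonneg.2 hp0.le) hxp.ne), ENNReal.le_rpow_inv_iff hp0]
    exact ENNReal.le_tsum k
  obtain ⟨y, hy, hanti, hxy⟩ := exists_antitone_rearrangement x hbdd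
  refine ⟨y, hy, hanti, tsum_ofReal_rpow_eq_of_encard_eq hp0 hx hy fun t ht => ?_, ?_⟩
  · simp only [hxy t ht, encard_setOf_natCast_lt]
  · refine ENNReal.summable.tsum_le_of_sum_le fun N => ?_
    exact (ENNReal.sum_rpow_le_sum_rpow_of_sum_le hp _ _ N
      fun M _ => h12.sum_mulVec_le hA hx hy hxy M).trans (ENNReal.sum_le_tsum _)
end

section
/- Let 1 ≤ p < ∞ and let A = (a_{j,k})_{j,k≥1} be a nonnegative matrix satisfying condition (4.1): a_{j,k} ≥ a_{j+1,k} for all j,k ≥ 1, and ∑_{j=1}^l a_{j,k} ≥ ∑_{j=1}^l a_{j,k+1} for all k,l ≥ 1. Then the ℓ_p-norm of A is determined by decreasing sequences: for every nonnegative sequence x with ∑_{k=1}^∞ x_k^p < ∞ there exists a nonnegative antitone sequence y with ∑_{k=1}^∞ y_k^p = ∑_{k=1}^∞ x_k^p and ∑_{j=1}^∞ ((Ay)_j)^p ≥ ∑_{j=1}^∞ ((Ax)_j)^p; moreover the same conclusion holds with the transpose Aᵗ (entries a_{k,j}) in place of A. -/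
open scoped ENNReal

/-- The `ℓ_p`-norm of `A` is determined by decreasing sequences: for every nonnegative
`x ∈ ℓ_p` there is a nonnegative decreasing `y` with the same `ℓ_p`-sum and
`∑_j ((Ay)_j)^p ≥ ∑_j ((Ax)_j)^p`. -/
def DetByDecr (p : ℝ) (A : ℕ → ℕ → ℝ) : Prop :=
  ∀ x : ℕ → ℝ, (∀ k, 0 ≤ x k) → (∑' k, ENNReal.ofReal (x k) ^ p) < ⊤ →
    ∃ y : ℕ → ℝ, (∀ k, 0 ≤ y k) ∧ Antitone y ∧
      (∑' k, ENNReal.ofReal (y k) ^ p) = (∑' k, ENNReal.ofReal (x k) ^ p) ∧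
      (∑' j, (mulVec A x j) ^ p) ≤ (∑' j, (mulVec A y j) ^ p)

open MeasureTheory in
theorem tsum_mul_eq_lintegral_withDensity (c : ℕ → ℝ≥0∞) (x : ℕ → ℝ) :
    ∑' k, c k * ENNReal.ofReal (x k) =
      ∫⁻ k, ENNReal.ofReal (x k) ∂(Measure.count.withDensity c) := by
  rw [lintegral_withDensity_eq_lintegral_mul _ measurable_from_top measurable_from_top,
    lintegral_count]
  rfl

theorem Finset.sum_le_sum_range_card_of_antitone {c : ℕ → ℝ≥0∞} (hc : Antitone c)
    (s : Finset ℕ) : ∑ k ∈ s, c k ≤ ∑ k ∈ Finset.range s.card, c k := by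
  induction s using Finset.induction_on_max with
  | empty => simp
  | insert a s ha ih =>
    have hmem : a ∉ s := fun h => lt_irrefl _ (ha a h)
    have hcard : s.card ≤ a := by
      simpa using Finset.card_le_card fun x hx => Finset.mem_range.2 (ha x hx)
    rw [Finset.sum_insert hmem, Finset.card_insert_of_notMem hmem, Finset.sum_range_succ, add_comm]
    exact add_le_add ih (hc hcard)

/-- The decreasing rearrangement of a sequence. -/
noncomputable def decrRearr (x : ℕ → ℝ) (n : ℕ) : ℝ :=
  sInf {t | 0 < t ∧ {k | t < x k}.ncard ≤ n}

theorem bddBelow_decrRearr_set (x : ℕ → ℝ) (n : ℕ) :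
    BddBelow {t | 0 < t ∧ {k | t < x k}.ncard ≤ n} :=
  ⟨0, fun _ ht => ht.1.le⟩

theorem decrRearr_nonneg (x : ℕ → ℝ) (n : ℕ) : 0 ≤ decrRearr x n :=
  Real.sInf_nonneg fun _ ht => ht.1.le

section

variable {x : ℕ → ℝ}

theorem nonempty_decrRearr_set (hx : ∀ t > 0, {k | t < x k}.Finite) (n : ℕ) :
    {t | 0 < t ∧ {k | t < x k}.ncard ≤ n}.Nonempty := by
  obtain ⟨M, hM⟩ := ((hx 1 one_pos).image x).bddAbove
  refine ⟨max M 1, by positivity, ?_⟩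
  have : {k | max M 1 < x k} = ∅ := by
    ext k
    simp only [Set.mem_ofPred_eq, Set.mem_empty_iff_false, iff_false, not_lt]
    by_cases hk : 1 < x k
    · exact le_max_of_le_left (hM ⟨k, hk, rfl⟩)
    · exact le_max_of_le_right (not_lt.1 hk)
  rw [this, Set.ncard_empty]
  exact n.zero_le

theorem decrRearr_antitone (hx : ∀ t > 0, {k | t < x k}.Finite) : Antitone (decrRearr x) :=
  fun _ n h => csInf_le_csInf (bddBelow_decrRearr_set x n) (nonempty_decrRearr_set hx _)
    fun _ ht => ⟨ht.1, ht.2.trans h⟩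

theorem lt_decrRearr_iff (hx : ∀ t > 0, {k | t < x k}.Finite) {t : ℝ} (ht : 0 < t) (n : ℕ) :
    t < decrRearr x n ↔ n < {k | t < x k}.ncard := by
  constructor
  · intro h
    by_contra! hn
    exact absurd (csInf_le (bddBelow_decrRearr_set x n) ⟨ht, hn⟩) (not_le.2 h)
  · intro h
    have hne : (hx t ht).toFinset.Nonempty := by
      rw [Set.Finite.toFinset_nonempty]
      exact Set.nonempty_of_ncard_ne_zero (by omega)
    obtain ⟨m, hm, hmin⟩ := Finset.exists_min_image _ x hne
    have htm : t < x m := by simpa using hm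
    refine htm.trans_le (le_csInf (nonempty_decrRearr_set hx n) fun s hs => ?_)
    by_contra! hsm
    have hsub : {k | t < x k} ⊆ {k | s < x k} := fun k hk =>
      hsm.trans_le (hmin k (by simpa using hk))
    have := Set.ncard_le_ncard hsub (hx s hs.1)
    exact absurd (h.trans_le this) (not_lt.2 hs.2)

theorem setOf_lt_decrRearr (hx : ∀ t > 0, {k | t < x k}.Finite) {t : ℝ} (ht : 0 < t) :
    {n | t < decrRearr x n} = Finset.range {k | t < x k}.ncard := by
  ext n
  simp [lt_decrRearr_iff hx ht]

open MeasureTheory in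
theorem tsum_decrRearr_rpow {p : ℝ} (hp : 0 < p) (hx0 : ∀ k, 0 ≤ x k)
    (hx : ∀ t > 0, {k | t < x k}.Finite) :
    ∑' k, ENNReal.ofReal (decrRearr x k) ^ p = ∑' k, ENNReal.ofReal (x k) ^ p := by
  have key : ∀ z : ℕ → ℝ, (∀ k, 0 ≤ z k) → ∑' k, ENNReal.ofReal (z k) ^ p =
      ENNReal.ofReal p * ∫⁻ t in Set.Ioi 0,
        Measure.count {k | t < z k} * ENNReal.ofReal (t ^ (p - 1)) := by
    intro z hz
    rw [← lintegral_rpow_eq_lintegral_meas_lt_mul _ (ae_of_all _ hz)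
      measurable_from_top.aemeasurable hp, lintegral_count]
    exact tsum_congr fun k => ENNReal.ofReal_rpow_of_nonneg (hz k) hp.le
  rw [key _ (decrRearr_nonneg x), key _ hx0]
  congr 1
  refine setLIntegral_congr_fun measurableSet_Ioi fun t ht => ?_
  rw [setOf_lt_decrRearr hx ht, Measure.count_apply_finset, Measure.count_apply_finite _ (hx t ht),
    Finset.card_range, Set.ncard_eq_toFinset_card _ (hx t ht)]

open MeasureTheory in
theorem tsum_mul_le_tsum_mul_decrRearr {c : ℕ → ℝ≥0∞} (hc : Antitone c) (hx0 : ∀ k, 0 ≤ x k)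
    (hx : ∀ t > 0, {k | t < x k}.Finite) :
    ∑' k, c k * ENNReal.ofReal (x k) ≤ ∑' k, c k * ENNReal.ofReal (decrRearr x k) := by
  rw [tsum_mul_eq_lintegral_withDensity, tsum_mul_eq_lintegral_withDensity,
    lintegral_eq_lintegral_meas_lt _ (ae_of_all _ hx0) measurable_from_top.aemeasurable,
    lintegral_eq_lintegral_meas_lt _ (ae_of_all _ (decrRearr_nonneg x))
      measurable_from_top.aemeasurable]
  refine setLIntegral_mono' measurableSet_Ioi fun t ht => ?_
  have hdens : ∀ s : Finset ℕ, Measure.count.withDensity c (s : Set ℕ) = ∑ k ∈ s, c k := by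
    intro s
    simp [withDensity_apply _ s.measurableSet, lintegral_finset]
  rw [setOf_lt_decrRearr hx ht, hdens, ← (hx t ht).coe_toFinset, hdens, Set.ncard_coe_finset]
  exact Finset.sum_le_sum_range_card_of_antitone hc _

end

theorem sum_range_mul_le_of_antitone {u v w : ℕ → ℝ} (hw0 : ∀ n, 0 ≤ w n) (hw : Antitone w)
    (h : ∀ l, ∑ j ∈ Finset.range l, u j ≤ ∑ j ∈ Finset.range l, v j) (n : ℕ) :
    ∑ j ∈ Finset.range n, u j * w j ≤ ∑ j ∈ Finset.range n, v j * w j := by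
  have key : (∑ j ∈ Finset.range n, v j - ∑ j ∈ Finset.range n, u j) * w n ≤
      ∑ j ∈ Finset.range n, v j * w j - ∑ j ∈ Finset.range n, u j * w j := by
    induction n with
    | zero => simp
    | succ n ih =>
      have hd := sub_nonneg.2 (h (n + 1))
      have hmono := mul_le_mul_of_nonneg_left (hw n.le_succ) hd
      refine hmono.trans ?_
      simp only [Finset.sum_range_succ]
      linarith
  have := mul_nonneg (sub_nonneg.2 (h n)) (hw0 n)
  linarith

theorem Real.rpow_add_mul_rpow_sub_one_le {p u v : ℝ} (hp : 1 ≤ p) (hu : 0 ≤ u) (hv : 0 ≤ v) :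
    u ^ p + p * (v * u ^ (p - 1) - u * u ^ (p - 1)) ≤ v ^ p := by
  rcases hu.eq_or_lt with rfl | hu
  · rcases hp.eq_or_lt with rfl | hp
    · simp
    · rw [Real.zero_rpow (by linarith), Real.zero_rpow (by linarith)]
      simpa using Real.rpow_nonneg hv p
  · have hb := one_add_mul_self_le_rpow_one_add (s := v / u - 1)
      (by have := div_nonneg hv hu.le; linarith) hp
    rw [add_sub_cancel, Real.div_rpow hv hu.le, le_div_iff₀ (Real.rpow_pos_of_pos hu p)] at hb
    have hup : u ^ p = u * u ^ (p - 1) := by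
      rw [Real.rpow_sub_one hu.ne']
      field_simp
    refine le_of_eq_of_le ?_ hb
    rw [hup]
    field_simp

/-- Weak majorization of an antitone sequence implies the inequality of `p`-th power sums. -/
theorem sum_range_rpow_le_of_sum_range_le {p : ℝ} (hp : 1 ≤ p) {u v : ℕ → ℝ} (hu0 : ∀ n, 0 ≤ u n)
    (hv0 : ∀ n, 0 ≤ v n) (hu : Antitone u)
    (h : ∀ l, ∑ j ∈ Finset.range l, u j ≤ ∑ j ∈ Finset.range l, v j) (n : ℕ) :
    ∑ j ∈ Finset.range n, u j ^ p ≤ ∑ j ∈ Finset.range n, v j ^ p := by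
  have hab := sum_range_mul_le_of_antitone (w := fun j => u j ^ (p - 1))
    (fun j => Real.rpow_nonneg (hu0 j) _)
    (fun i j hij => Real.rpow_le_rpow (hu0 j) (hu hij) (by linarith)) h n
  have ht := Finset.sum_le_sum fun j (_ : j ∈ Finset.range n) =>
    Real.rpow_add_mul_rpow_sub_one_le hp (hu0 j) (hv0 j)
  rw [Finset.sum_add_distrib, ← Finset.mul_sum, Finset.sum_sub_distrib] at ht
  have := mul_nonneg (zero_le_one.trans hp) (sub_nonneg.2 hab)
  linarith

theorem ENNReal.tsum_rpow_le_of_sum_range_le {p : ℝ} (hp : 1 ≤ p) {u v : ℕ → ℝ≥0∞}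
    (hu : Antitone u)
    (h : ∀ l, ∑ j ∈ Finset.range l, u j ≤ ∑ j ∈ Finset.range l, v j) :
    ∑' j, u j ^ p ≤ ∑' j, v j ^ p := by
  have hp0 : 0 < p := zero_lt_one.trans_le hp
  by_cases hv : ∃ j, v j = ⊤
  · obtain ⟨j, hj⟩ := hv
    rw [ENNReal.tsum_eq_top_of_eq_top (f := fun j => v j ^ p) ⟨j, by simp [hj, hp0]⟩]
    exact le_top
  push Not at hv
  have hut : ∀ j, u j ≠ ⊤ := fun j => by
    refine ne_top_of_le_ne_top (ENNReal.sum_ne_top.2 fun i _ => hv i)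
      (le_trans ?_ (h (j + 1)))
    exact Finset.single_le_sum (f := u) (fun _ _ => zero_le) (Finset.self_mem_range_succ j)
  have hreal := sum_range_rpow_le_of_sum_range_le hp (u := fun j => (u j).toReal)
    (v := fun j => (v j).toReal) (fun _ => ENNReal.toReal_nonneg) (fun _ => ENNReal.toReal_nonneg)
    (fun i j hij => ENNReal.toReal_mono (hut i) (hu hij))
    (fun l => by
      rw [← ENNReal.toReal_sum fun i _ => hut i, ← ENNReal.toReal_sum fun i _ => hv i]
      exact ENNReal.toReal_mono (ENNReal.sum_ne_top.2 fun i _ => hv i) (h l))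
  refine ENNReal.tsum_le_of_sum_range_le fun n => le_trans ?_ (ENNReal.sum_le_tsum (Finset.range n))
  have hup : ∀ i, u i ^ p ≠ ⊤ := fun i => ENNReal.rpow_ne_top_of_nonneg hp0.le (hut i)
  have hvp : ∀ i, v i ^ p ≠ ⊤ := fun i => ENNReal.rpow_ne_top_of_nonneg hp0.le (hv i)
  rw [← ENNReal.toReal_le_toReal (ENNReal.sum_ne_top.2 fun i _ => hup i)
    (ENNReal.sum_ne_top.2 fun i _ => hvp i), ENNReal.toReal_sum fun i _ => hup i,
    ENNReal.toReal_sum fun i _ => hvp i]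
  simpa only [ENNReal.toReal_rpow] using hreal n

theorem finite_setOf_lt_of_tsum_rpow_lt_top {p : ℝ} (hp : 0 < p) {x : ℕ → ℝ}
    (h : ∑' k, ENNReal.ofReal (x k) ^ p < ⊤) {t : ℝ} (ht : 0 < t) : {k | t < x k}.Finite := by
  refine (ENNReal.finite_const_le_of_tsum_ne_top h.ne (ε := ENNReal.ofReal t ^ p) ?_).subset
    fun k hk => ?_
  · simp [ENNReal.rpow_eq_zero_iff, ht]
  · exact ENNReal.rpow_le_rpow (ENNReal.ofReal_le_ofReal (le_of_lt hk)) hp.le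

theorem detByDecr_of_decrRearr {p : ℝ} (hp : 0 < p) {A : ℕ → ℕ → ℝ}
    (h : ∀ x : ℕ → ℝ, (∀ k, 0 ≤ x k) → (∀ t > 0, {k | t < x k}.Finite) →
      ∑' j, mulVec A x j ^ p ≤ ∑' j, mulVec A (decrRearr x) j ^ p) : DetByDecr p A := by
  intro x hx0 hx
  have hfin : ∀ t > 0, {k | t < x k}.Finite := fun t ht =>
    finite_setOf_lt_of_tsum_rpow_lt_top hp hx ht
  exact ⟨decrRearr x, decrRearr_nonneg x, decrRearr_antitone hfin,
    tsum_decrRearr_rpow hp hx0 hfin, h x hx0 hfin⟩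

theorem sum_mulVec {A : ℕ → ℕ → ℝ} (hA : ∀ j k, 0 ≤ A j k) (x : ℕ → ℝ) (s : Finset ℕ) :
    ∑ j ∈ s, mulVec A x j =
      ∑' k, ENNReal.ofReal (∑ j ∈ s, A j k) * ENNReal.ofReal (x k) := by
  simp only [mulVec]
  rw [← Summable.tsum_finsetSum fun _ _ => ENNReal.summable]
  refine tsum_congr fun k => ?_
  rw [ENNReal.ofReal_sum_of_nonneg fun j _ => hA j k, Finset.sum_mul]
  exact Finset.sum_congr rfl fun j _ => ENNReal.ofReal_mul (hA j k)

/-- Corollary 4.2 for `E = F = ℓ_p`: if the nonnegative matrix `A` satisfies (4.1), i.e.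
`a_{j,k} ≥ a_{j+1,k}` for all `j,k ≥ 1`, and `∑_{j=1}^l a_{j,k} ≥ ∑_{j=1}^l a_{j,k+1}`
for all `k, l ≥ 1`, then the `ℓ_p`-norm of `A` is determined by decreasing sequences,
and the same holds with the transpose `Aᵗ` in place of `A`. -/
theorem lp_norm_determined_by_decreasing_of_cond41
    (p : ℝ) (hp : 1 ≤ p)
    (A : ℕ → ℕ → ℝ) (hA : ∀ j k, 0 ≤ A j k)
    (h1 : ∀ j k, A (j + 1) k ≤ A j k)
    (h2 : ∀ k l : ℕ, 1 ≤ l →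
      ∑ j ∈ Finset.range l, A j (k + 1) ≤ ∑ j ∈ Finset.range l, A j k) :
    DetByDecr p A ∧ DetByDecr p (fun j k => A k j) := by
  have hp0 : 0 < p := zero_lt_one.trans_le hp
  refine ⟨detByDecr_of_decrRearr hp0 fun x hx0 hfin => ?_,
    detByDecr_of_decrRearr hp0 fun x hx0 hfin => ?_⟩
  · refine ENNReal.tsum_rpow_le_of_sum_range_le hp (antitone_nat_of_succ_le fun j => ?_)
      fun l => ?_
    · exact ENNReal.tsum_le_tsum fun k =>
        ENNReal.ofReal_le_ofReal (mul_le_mul_of_nonneg_right (h1 j k) (hx0 k))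
    · rw [sum_mulVec hA, sum_mulVec hA]
      refine tsum_mul_le_tsum_mul_decrRearr (antitone_nat_of_succ_le fun k => ?_) hx0 hfin
      rcases Nat.eq_zero_or_pos l with rfl | hl
      · simp
      · exact ENNReal.ofReal_le_ofReal (h2 k l hl)
  · refine ENNReal.tsum_le_tsum fun j => ENNReal.rpow_le_rpow ?_ hp0.le
    simp only [mulVec, ENNReal.ofReal_mul (hA _ _)]
    exact tsum_mul_le_tsum_mul_decrRearr
      (antitone_nat_of_succ_le fun k => ENNReal.ofReal_le_ofReal (h1 k j)) hx0 hfin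
end

section
/- Let w = (w_n)_{n≥1} be antitone with w_1 > 0 and w_n ≥ 0 for all n, and let 1 ≤ p < ∞. Let T = (A_W^{WM})ᵗ be the transpose of the weighted mean matrix, i.e., t_{j,k} = w_j/(w_1+⋯+w_k) for k ≥ j and t_{j,k} = 0 for k < j. Then the ℓ_p-norm of T is determined by decreasing sequences: for every nonnegative sequence x with ∑_{k=1}^∞ x_k^p < ∞ there exists a nonnegative antitone sequence y with ∑_{k=1}^∞ y_k^p = ∑_{k=1}^∞ x_k^p and ∑_{j=1}^∞ ((Ty)_j)^p ≥ ∑_{j=1}^∞ ((Tx)_j)^p; moreover the same conclusion holds with the weighted mean matrix A_W^{WM} itself in place of T. -/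
open scoped ENNReal

/-- The weighted mean matrix `A_W^{WM}`: entries `w_k / (w_1 + ⋯ + w_j)` for `j ≥ k`
and `0` for `j < k` (in the paper's 1-based indexing; here 0-based). -/
noncomputable def weightedMeanMatrix (w : ℕ → ℝ) : ℕ → ℕ → ℝ := fun j k =>
  if k ≤ j then w k / (∑ i ∈ Finset.range (j + 1), w i) else 0

/-- Abel summation: dominated partial sums stay dominated after weighting by a nonnegative
antitone sequence. -/
theorem Antitone.sum_range_mul_le_sum_range_mul {c a b : ℕ → ℝ} (hc : Antitone c)
    (hc0 : ∀ n, 0 ≤ c n)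
    (h : ∀ m, ∑ j ∈ Finset.range m, a j ≤ ∑ j ∈ Finset.range m, b j) (N : ℕ) :
    ∑ j ∈ Finset.range N, c j * a j ≤ ∑ j ∈ Finset.range N, c j * b j := by
  have key : ∀ n, c n * (∑ j ∈ Finset.range (n + 1), b j - ∑ j ∈ Finset.range (n + 1), a j) ≤
      ∑ j ∈ Finset.range (n + 1), c j * b j - ∑ j ∈ Finset.range (n + 1), c j * a j := by
    intro n
    induction n with
    | zero => simp [mul_sub]
    | succ n ih =>
      rw [Finset.sum_range_succ b, Finset.sum_range_succ a,
        Finset.sum_range_succ (fun j => c j * b j), Finset.sum_range_succ (fun j => c j * a j)]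
      nlinarith [mul_le_mul_of_nonneg_right (hc n.le_succ) (sub_nonneg.2 (h (n + 1)))]
  cases N with
  | zero => simp
  | succ n => nlinarith [key n, mul_nonneg (hc0 n) (sub_nonneg.2 (h (n + 1)))]

/-- The tangent line inequality for `t ↦ t ^ p`. -/
theorem Real.rpow_add_mul_sub_le_rpow {a b p : ℝ} (ha : 0 ≤ a) (hb : 0 ≤ b) (hp : 1 ≤ p) :
    a ^ p + p * a ^ (p - 1) * (b - a) ≤ b ^ p := by
  rcases ha.eq_or_lt with rfl | ha
  · rcases hp.eq_or_lt with rfl | hp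
    · simp
    · rw [Real.zero_rpow (by linarith), Real.zero_rpow (by linarith)]
      simpa using Real.rpow_nonneg hb p
  · have h := one_add_mul_self_le_rpow_one_add (s := b / a - 1)
      (by linarith [div_nonneg hb ha.le]) hp
    rw [add_sub_cancel, Real.div_rpow hb ha.le, le_div_iff₀ (Real.rpow_pos_of_pos ha p)] at h
    have h1 : a ^ p = a ^ (p - 1) * a := by
      rw [Real.rpow_sub_one ha.ne', div_mul_cancel₀ _ ha.ne']
    have h2 : (1 + p * (b / a - 1)) * a ^ p = a ^ p + p * a ^ (p - 1) * (b - a) := by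
      rw [h1]; field_simp
    linarith

/-- Weak majorization by partial sums implies the inequality of `ℓ_p`-sums; only the smaller
sequence has to be antitone. -/
theorem ENNReal.tsum_rpow_le_tsum_rpow_of_sum_range_le {p : ℝ} (hp : 1 ≤ p) {a b : ℕ → ℝ≥0∞}
    (ha : Antitone a)
    (h : ∀ m, ∑ j ∈ Finset.range m, a j ≤ ∑ j ∈ Finset.range m, b j) :
    ∑' j, a j ^ p ≤ ∑' j, b j ^ p := by
  have hp0 : 0 ≤ p := zero_le_one.trans hp
  by_cases hb : ∃ j, b j = ⊤
  · obtain ⟨j, hj⟩ := hb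
    refine le_top.trans (le_of_eq_of_le ?_ (ENNReal.le_tsum j))
    rw [hj, ENNReal.top_rpow_of_pos (by linarith)]
  push Not at hb
  have ha' : ∀ j, a j ≠ ⊤ := fun j =>
    ne_top_of_le_ne_top (ENNReal.sum_ne_top.2 fun i _ => hb i)
      ((Finset.single_le_sum (fun _ _ => zero_le) (Finset.self_mem_range_succ j)).trans
        (h (j + 1)))
  refine ENNReal.tsum_le_of_sum_range_le fun N => le_trans ?_ (ENNReal.sum_le_tsum (Finset.range N))
  have hR : ∀ m, ∑ j ∈ Finset.range m, (a j).toReal ≤ ∑ j ∈ Finset.range m, (b j).toReal := by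
    intro m
    rw [← ENNReal.toReal_sum fun i _ => ha' i, ← ENNReal.toReal_sum fun i _ => hb i]
    exact ENNReal.toReal_mono (ENNReal.sum_ne_top.2 fun i _ => hb i) (h m)
  have hc : Antitone fun j => p * (a j).toReal ^ (p - 1) := fun i j hij =>
    mul_le_mul_of_nonneg_left (Real.rpow_le_rpow ENNReal.toReal_nonneg
      (ENNReal.toReal_mono (ha' i) (ha hij)) (by linarith)) hp0
  have habel := hc.sum_range_mul_le_sum_range_mul
    (fun n => mul_nonneg hp0 (Real.rpow_nonneg ENNReal.toReal_nonneg _)) hR N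
  have htan := Finset.sum_le_sum fun j (_ : j ∈ Finset.range N) =>
    Real.rpow_add_mul_sub_le_rpow (ENNReal.toReal_nonneg (a := a j))
      (ENNReal.toReal_nonneg (a := b j)) hp
  simp only [mul_sub, Finset.sum_add_distrib, Finset.sum_sub_distrib] at htan
  rw [← ENNReal.toReal_le_toReal
      (ENNReal.sum_ne_top.2 fun i _ => ENNReal.rpow_ne_top_of_nonneg hp0 (ha' i))
      (ENNReal.sum_ne_top.2 fun i _ => ENNReal.rpow_ne_top_of_nonneg hp0 (hb i)),
    ENNReal.toReal_sum fun i _ => ENNReal.rpow_ne_top_of_nonneg hp0 (ha' i),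
    ENNReal.toReal_sum fun i _ => ENNReal.rpow_ne_top_of_nonneg hp0 (hb i)]
  simp only [← ENNReal.toReal_rpow]
  linarith

theorem Antitone.sum_le_sum_range_card {y : ℕ → ℝ} (hy : Antitone y) (s : Finset ℕ) :
    ∑ n ∈ s, y n ≤ ∑ n ∈ Finset.range s.card, y n := by
  induction s using Finset.induction_on_max with
  | empty => simp
  | insert a s hs ih =>
    have hna : a ∉ s := fun h => (hs a h).false
    have hcard : s.card ≤ a := by
      simpa using Finset.card_le_card (fun i hi => Finset.mem_range.2 (hs i hi) : s ⊆ Finset.range a)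
    rw [Finset.sum_insert hna, Finset.card_insert_of_notMem hna, Finset.sum_range_succ]
    linarith [hy hcard]

/-- Existence of the decreasing rearrangement of a nonnegative sequence all of whose positive
superlevel sets are finite: the positive terms are placed injectively, in decreasing order. -/
theorem exists_antitone_extend {x : ℕ → ℝ} (hx : ∀ k, 0 ≤ x k)
    (hfin : ∀ ε, 0 < ε → {i | ε ≤ x i}.Finite) :
    ∃ r : {k // 0 < x k} → ℕ, Function.Injective r ∧
      Antitone (Function.extend r (fun k => x k) 0) := by
  let P : ℕ → Set ℕ := fun k => {i | x k < x i ∨ (x i = x k ∧ i < k)}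
  have hPfin : ∀ k, 0 < x k → (P k).Finite := fun k hk =>
    (hfin _ hk).subset fun i hi => hi.elim le_of_lt fun h => h.1.ge
  have hlt : ∀ i k, 0 < x k → i ∈ P k → (P i).ncard < (P k).ncard := by
    intro i k hk hik
    refine Set.ncard_lt_ncard ⟨?_, ?_⟩ (hPfin k hk)
    · intro l hl
      simp only [P, Set.mem_ofPred_eq] at *
      grind
    · intro h
      simpa [P] using h hik
  have htri : ∀ i k, i ∈ P k ∨ i = k ∨ k ∈ P i := by
    intro i k
    simp only [P, Set.mem_ofPred_eq]
    grind
  have hPpos : ∀ i k, 0 < x k → i ∈ P k → 0 < x i := fun i k hk hi =>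
    hi.elim hk.trans fun h => h.1 ▸ hk
  let r : {k // 0 < x k} → ℕ := fun k => (P k).ncard
  have hr : Function.Injective r := by
    intro i k hik
    rcases htri i k with h | h | h
    · exact absurd hik (hlt _ _ k.2 h).ne
    · exact Subtype.ext h
    · exact absurd hik (hlt _ _ i.2 h).ne'
  refine ⟨r, hr, fun m n hmn => ?_⟩
  by_cases hn : ∃ k, r k = n
  · obtain ⟨k, rfl⟩ := hn
    rw [hr.extend_apply]
    rcases hmn.eq_or_lt with rfl | hmn
    · rw [hr.extend_apply]
    have hm : ∃ i ∈ P k, (P i).ncard = m := by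
      have hsub : Set.image (fun i => (P i).ncard) (P k) ⊆ Set.Iio (r k) := by
        rintro _ ⟨i, hi, rfl⟩
        exact hlt i k k.2 hi
      have hinj : Set.InjOn (fun i => (P i).ncard) (P k) := fun i hi j hj hij =>
        congrArg Subtype.val (@hr ⟨i, hPpos i k k.2 hi⟩ ⟨j, hPpos j k k.2 hj⟩ hij)
      have himg := Set.eq_of_subset_of_ncard_le hsub
        (by rw [hinj.ncard_image, ← Finset.coe_Iio, Set.ncard_coe_finset,
              Nat.card_Iio]) (Set.finite_Iio _)
      exact himg.ge hmn
    obtain ⟨i, hi, rfl⟩ := hm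
    have := hr.extend_apply (fun k => x k) 0 ⟨i, hPpos i k k.2 hi⟩
    simp only [r] at this
    rw [this]
    exact hi.elim le_of_lt fun h => h.1.ge
  · rw [Function.extend_apply' _ _ _ hn]
    by_cases hm : ∃ k, r k = m
    · obtain ⟨k, rfl⟩ := hm
      rw [hr.extend_apply]
      exact hx k
    · rw [Function.extend_apply' _ _ _ hm]; rfl

/-- A nonnegative `ℓ_p` sequence has an antitone rearrangement with the same `ℓ_p`-sum and larger
partial sums. -/
theorem exists_antitone_rearrangement_s5 {p : ℝ} (hp : 1 ≤ p) {x : ℕ → ℝ} (hx : ∀ k, 0 ≤ x k)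
    (hsum : ∑' k, ENNReal.ofReal (x k) ^ p < ⊤) :
    ∃ y : ℕ → ℝ, (∀ k, 0 ≤ y k) ∧ Antitone y ∧
      ∑' k, ENNReal.ofReal (y k) ^ p = ∑' k, ENNReal.ofReal (x k) ^ p ∧
      ∀ m, ∑ j ∈ Finset.range m, x j ≤ ∑ j ∈ Finset.range m, y j := by
  have hp0 : 0 < p := by linarith
  have hfin : ∀ ε, 0 < ε → {i | ε ≤ x i}.Finite := by
    intro ε hε
    refine (ENNReal.finite_const_le_of_tsum_ne_top hsum.ne
      (ENNReal.rpow_pos (p := p) (ENNReal.ofReal_pos.2 hε) ENNReal.ofReal_ne_top).ne').subset ?_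
    intro i hi
    exact ENNReal.rpow_le_rpow (ENNReal.ofReal_le_ofReal hi) hp0.le
  obtain ⟨r, hr, hanti⟩ := exists_antitone_extend hx hfin
  have hy0 : ∀ n, 0 ≤ Function.extend r (fun k => x k) 0 n := by
    intro n
    by_cases hn : ∃ k, r k = n
    · obtain ⟨k, rfl⟩ := hn
      rw [hr.extend_apply]
      exact hx k
    · rw [Function.extend_apply' _ _ _ hn]; rfl
  refine ⟨_, hy0, hanti, ?_, fun m => ?_⟩
  · have h1 : ∀ n, ENNReal.ofReal (Function.extend r (fun k => x k) 0 n) ^ p =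
        Function.extend r (fun k => ENNReal.ofReal (x k) ^ p) 0 n := by
      intro n
      by_cases hn : ∃ k, r k = n
      · obtain ⟨k, rfl⟩ := hn
        rw [hr.extend_apply, hr.extend_apply]
      · rw [Function.extend_apply' _ _ _ hn, Function.extend_apply' _ _ _ hn]
        simp [hp0]
    rw [tsum_congr h1, tsum_extend_zero hr]
    refine tsum_subtype_eq_of_support_subset (s := {k | 0 < x k})
      (f := fun k => ENNReal.ofReal (x k) ^ p) fun k hk => ?_
    by_contra hk0
    exact hk (by simp [ENNReal.ofReal_of_nonpos (not_lt.1 hk0), hp0])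
  · let y := Function.extend r (fun k => x k) 0
    let s : Finset {k // 0 < x k} := (Finset.range m).subtype _
    calc ∑ j ∈ Finset.range m, x j = ∑ k ∈ s, x k := by
          rw [Finset.sum_subtype_eq_sum_filter]
          refine (Finset.sum_filter_of_ne fun k _ hk => ?_).symm
          exact (hx k).lt_of_ne' hk
      _ = ∑ n ∈ s.map ⟨r, hr⟩, y n := by
          rw [Finset.sum_map]
          exact Finset.sum_congr rfl fun k _ => (hr.extend_apply (fun k => x k) 0 k).symm
      _ ≤ ∑ n ∈ Finset.range (s.map ⟨r, hr⟩).card, y n := hanti.sum_le_sum_range_card _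
      _ ≤ ∑ n ∈ Finset.range m, y n := by
          refine Finset.sum_le_sum_of_subset_of_nonneg (Finset.range_mono ?_) fun n _ _ => hy0 n
          rw [Finset.card_map, Finset.card_subtype]
          exact (Finset.card_filter_le _ _).trans (Finset.card_range m).le

/-- Pairing with a nonnegative antitone sequence is monotone with respect to partial sums. -/
theorem Antitone.tsum_ofReal_mul_le {c x y : ℕ → ℝ} (hc : Antitone c) (hc0 : ∀ n, 0 ≤ c n)
    (hx : ∀ n, 0 ≤ x n) (hy : ∀ n, 0 ≤ y n)
    (h : ∀ m, ∑ j ∈ Finset.range m, x j ≤ ∑ j ∈ Finset.range m, y j) :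
    ∑' k, ENNReal.ofReal (c k * x k) ≤ ∑' k, ENNReal.ofReal (c k * y k) := by
  refine ENNReal.tsum_le_of_sum_range_le fun N => le_trans ?_ (ENNReal.sum_le_tsum (Finset.range N))
  rw [← ENNReal.ofReal_sum_of_nonneg fun i _ => mul_nonneg (hc0 i) (hx i),
    ← ENNReal.ofReal_sum_of_nonneg fun i _ => mul_nonneg (hc0 i) (hy i)]
  exact ENNReal.ofReal_le_ofReal (hc.sum_range_mul_le_sum_range_mul hc0 h N)

section WeightedMean

variable {w : ℕ → ℝ}

theorem sum_range_succ_pos_of_weights (hw0 : 0 < w 0) (hw : ∀ n, 0 ≤ w n) (j : ℕ) :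
    0 < ∑ i ∈ Finset.range (j + 1), w i :=
  Finset.sum_pos' (fun i _ => hw i) ⟨0, by simp, hw0⟩

theorem weightedMeanMatrix_nonneg (hw : ∀ n, 0 ≤ w n) (j k : ℕ) : 0 ≤ weightedMeanMatrix w j k := by
  unfold weightedMeanMatrix
  split_ifs
  · exact div_nonneg (hw k) (Finset.sum_nonneg fun i _ => hw i)
  · rfl

theorem weightedMeanMatrix_row_antitone (hw : ∀ n, 0 ≤ w n) (hwa : Antitone w) (j : ℕ) :
    Antitone (weightedMeanMatrix w j) := by
  intro k l hkl
  by_cases hl : l ≤ j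
  · simp only [weightedMeanMatrix, if_pos hl, if_pos (hkl.trans hl)]
    exact div_le_div_of_nonneg_right (hwa hkl) (Finset.sum_nonneg fun i _ => hw i)
  · rw [weightedMeanMatrix, if_neg hl]
    exact weightedMeanMatrix_nonneg hw j k

theorem sum_range_weightedMeanMatrix_antitone (hw0 : 0 < w 0) (hw : ∀ n, 0 ≤ w n) (m : ℕ) :
    Antitone fun k => ∑ j ∈ Finset.range m, weightedMeanMatrix w k j := by
  have hval : ∀ k, ∑ j ∈ Finset.range m, weightedMeanMatrix w k j =
      (∑ j ∈ Finset.range (min m (k + 1)), w j) / ∑ i ∈ Finset.range (k + 1), w i := by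
    intro k
    rw [Finset.sum_div, ← Finset.sum_filter_of_ne (p := fun j => j ≤ k)]
    · refine Finset.sum_congr ?_ fun j hj => ?_
      · ext j
        simp only [Finset.mem_filter, Finset.mem_range]
        omega
      · have : j ≤ k := by simp only [Finset.mem_range] at hj; omega
        simp [weightedMeanMatrix, this]
    · intro j _ hj
      by_contra hjk
      exact hj (by simp [weightedMeanMatrix, hjk])
  have hmono : Monotone fun n => ∑ i ∈ Finset.range n, w i := fun a b hab =>
    Finset.sum_le_sum_of_subset_of_nonneg (Finset.range_mono hab) fun i _ _ => hw i
  refine antitone_nat_of_succ_le fun k => ?_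
  simp only [hval]
  rcases le_or_gt m (k + 1) with hm | hm
  · rw [min_eq_left hm, min_eq_left (hm.trans (k + 1).le_succ)]
    exact div_le_div_of_nonneg_left (Finset.sum_nonneg fun i _ => hw i)
      (sum_range_succ_pos_of_weights hw0 hw k) (hmono (k + 1).le_succ)
  · rw [min_eq_right hm.le, div_self (sum_range_succ_pos_of_weights hw0 hw k).ne']
    exact div_le_one_of_le₀ (hmono (min_le_right _ _)) (sum_range_succ_pos_of_weights hw0 hw _).le

end WeightedMean

/-- Corollary 4.3(i) for `E = F = ℓ_p`: if `w` is nonnegative, decreasing, with `w_1 > 0`,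
then the `ℓ_p`-norm of the transpose `T = (A_W^{WM})ᵗ` of the weighted mean matrix is
determined by decreasing sequences, and the same holds for `A_W^{WM}` itself. -/
theorem lp_norm_determined_by_decreasing_weightedMean_transpose
    (p : ℝ) (hp : 1 ≤ p)
    (w : ℕ → ℝ) (hw0 : 0 < w 0) (hw : ∀ n, 0 ≤ w n) (hwa : Antitone w) :
    DetByDecr p (fun j k => weightedMeanMatrix w k j) ∧
      DetByDecr p (weightedMeanMatrix w) := by
  constructor
  · intro x hx hsum
    obtain ⟨y, hy, hya, hxy, hpart⟩ := exists_antitone_rearrangement_s5 hp hx hsum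
    refine ⟨y, hy, hya, hxy, ENNReal.tsum_rpow_le_tsum_rpow_of_sum_range_le hp ?_ fun m => ?_⟩
    · intro i j hij
      exact ENNReal.tsum_le_tsum fun k => ENNReal.ofReal_le_ofReal
        (mul_le_mul_of_nonneg_right (weightedMeanMatrix_row_antitone hw hwa k hij) (hx k))
    · have hcol : ∀ z : ℕ → ℝ, (∀ k, 0 ≤ z k) →
          ∑ j ∈ Finset.range m, mulVec (fun j k => weightedMeanMatrix w k j) z j =
            ∑' k, ENNReal.ofReal ((∑ j ∈ Finset.range m, weightedMeanMatrix w k j) * z k) := by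
        intro z hz
        simp only [mulVec]
        rw [← Summable.tsum_finsetSum fun _ _ => ENNReal.summable]
        refine tsum_congr fun k => ?_
        rw [Finset.sum_mul, ENNReal.ofReal_sum_of_nonneg fun j _ =>
          mul_nonneg (weightedMeanMatrix_nonneg hw k j) (hz k)]
      rw [hcol x hx, hcol y hy]
      exact (sum_range_weightedMeanMatrix_antitone hw0 hw m).tsum_ofReal_mul_le
        (fun k => Finset.sum_nonneg fun j _ => weightedMeanMatrix_nonneg hw k j) hx hy hpart
  · intro x hx hsum
    obtain ⟨y, hy, hya, hxy, hpart⟩ := exists_antitone_rearrangement_s5 hp hx hsum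
    refine ⟨y, hy, hya, hxy, ENNReal.tsum_le_tsum fun j =>
      ENNReal.rpow_le_rpow ?_ (zero_le_one.trans hp)⟩
    exact (weightedMeanMatrix_row_antitone hw hwa j).tsum_ofReal_mul_le
      (weightedMeanMatrix_nonneg hw j) hx hy hpart
end

section
/- Let w = (w_n)_{n≥1} satisfy w_1 > 0, w_n ≤ w_{n+1} for all n (w is nondecreasing), and w_{n+1}/w_n ≤ w_n/w_{n−1} for all n ≥ 2, and let 1 ≤ p < ∞. Let T = (A_W^{NM})ᵗ be the transpose of the Nörlund mean matrix, i.e., t_{j,k} = w_{k−j+1}/(w_1+⋯+w_k) for k ≥ j and t_{j,k} = 0 for k < j. Then the ℓ_p-norm of T is determined by decreasing sequences: for every nonnegative sequence x with ∑_{k=1}^∞ x_k^p < ∞ there exists a nonnegative antitone sequence y with ∑_{k=1}^∞ y_k^p = ∑_{k=1}^∞ x_k^p and ∑_{j=1}^∞ ((Ty)_j)^p ≥ ∑_{j=1}^∞ ((Tx)_j)^p; moreover the same conclusion holds with the Nörlund mean matrix A_W^{NM} itself in place of T. -/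
open scoped ENNReal

/-- The Nörlund mean matrix `A_W^{NM}`: entries `w_{j-k+1} / (w_1 + ⋯ + w_j)` for `j ≥ k`
and `0` for `j < k` (in the paper's 1-based indexing; here 0-based, so the entry is
`w_{j-k} / (w_0 + ⋯ + w_j)` for `k ≤ j`). -/
noncomputable def norlundMatrix (w : ℕ → ℝ) : ℕ → ℕ → ℝ := fun j k =>
  if k ≤ j then w (j - k) / (∑ i ∈ Finset.range (j + 1), w i) else 0

/-- Chebyshev-type summation by parts: weighting by a nonnegative antitone sequence preserves
domination of partial sums. -/
theorem sum_mul_le_sum_mul_of_partial_sums_le {z a b : ℕ → ℝ} (hz : Antitone z)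
    (hz0 : ∀ i, 0 ≤ z i)
    (hab : ∀ n, ∑ i ∈ Finset.range n, a i ≤ ∑ i ∈ Finset.range n, b i) (n : ℕ) :
    ∑ i ∈ Finset.range n, z i * a i ≤ ∑ i ∈ Finset.range n, z i * b i := by
  have key : ∀ n, z n * (∑ i ∈ Finset.range (n + 1), b i - ∑ i ∈ Finset.range (n + 1), a i) ≤
      ∑ i ∈ Finset.range (n + 1), z i * b i - ∑ i ∈ Finset.range (n + 1), z i * a i := by
    intro n
    induction n with
    | zero => simp [mul_sub]
    | succ n ih =>
      rw [Finset.sum_range_succ _ (n + 1), Finset.sum_range_succ _ (n + 1),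
        Finset.sum_range_succ _ (n + 1), Finset.sum_range_succ _ (n + 1)]
      have h := mul_le_mul_of_nonneg_right (hz n.le_succ) (sub_nonneg.2 (hab (n + 1)))
      simp only [Nat.succ_eq_add_one] at h
      linarith
  cases n with
  | zero => simp
  | succ n =>
    have h := mul_nonneg (hz0 n) (sub_nonneg.2 (hab (n + 1)))
    linarith [key n]

theorem ENNReal.tsum_mul_le_tsum_mul_of_partial_sums_le {z a b : ℕ → ℝ≥0∞} (hz : Antitone z)
    (hz_top : ∀ i, z i ≠ ⊤) (ha : ∀ i, a i ≠ ⊤) (hb : ∀ i, b i ≠ ⊤)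
    (hab : ∀ n, ∑ i ∈ Finset.range n, a i ≤ ∑ i ∈ Finset.range n, b i) :
    ∑' i, z i * a i ≤ ∑' i, z i * b i := by
  lift z to ℕ → NNReal using hz_top
  lift a to ℕ → NNReal using ha
  lift b to ℕ → NNReal using hb
  have hz' : ∀ ⦃i j⦄, i ≤ j → z j ≤ z i := fun i j h => ENNReal.coe_le_coe.1 (hz h)
  beta_reduce at hab ⊢
  refine ENNReal.tsum_le_of_sum_range_le fun n => le_trans ?_ (ENNReal.sum_le_tsum (Finset.range n))
  have := sum_mul_le_sum_mul_of_partial_sums_le (z := fun i => (z i : ℝ)) (a := fun i => (a i : ℝ))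
    (b := fun i => (b i : ℝ)) (fun i j h => by exact_mod_cast hz' h) (fun i => (z i).coe_nonneg)
    (fun n => by exact_mod_cast hab n) n
  beta_reduce at this
  exact_mod_cast this

theorem Real.mul_rpow_sub_one_mul_le {p : ℝ} (hp : 1 ≤ p) {a b : ℝ} (ha : 0 ≤ a) (hb : 0 ≤ b) :
    p * (a ^ (p - 1) * b) ≤ (p - 1) * a ^ p + b ^ p := by
  rcases ha.eq_or_lt with rfl | ha
  · rcases hp.eq_or_lt with rfl | hp
    · simp
    · rw [Real.zero_rpow (by linarith), Real.zero_rpow (by linarith)]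
      simpa using Real.rpow_nonneg hb p
  · have h := one_add_mul_self_le_rpow_one_add (s := b / a - 1)
      (by linarith [div_nonneg hb ha.le]) hp
    rw [add_sub_cancel, Real.div_rpow hb ha.le, le_div_iff₀ (Real.rpow_pos_of_pos ha p)] at h
    have e : a ^ p = a ^ (p - 1) * a := by
      rw [← Real.rpow_add_one ha.ne', sub_add_cancel]
    have e' : (1 + p * (b / a - 1)) * a ^ p = p * (a ^ (p - 1) * b) - (p - 1) * a ^ p := by
      rw [e]; field_simp; ring
    linarith

/-- Weak majorization by an antitone sequence passes to sums of `p`-th powers. -/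
theorem ENNReal.tsum_rpow_le_of_partial_sums_le {p : ℝ} (hp : 1 ≤ p) {a b : ℕ → ℝ≥0∞}
    (ha : Antitone a) (ha_top : ∀ i, a i ≠ ⊤) (hb_top : ∀ i, b i ≠ ⊤)
    (hab : ∀ n, ∑ i ∈ Finset.range n, a i ≤ ∑ i ∈ Finset.range n, b i) :
    ∑' i, a i ^ p ≤ ∑' i, b i ^ p := by
  lift a to ℕ → NNReal using ha_top
  lift b to ℕ → NNReal using hb_top
  have ha' : ∀ ⦃i j⦄, i ≤ j → a j ≤ a i := fun i j h => ENNReal.coe_le_coe.1 (ha h)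
  beta_reduce at hab ⊢
  refine ENNReal.tsum_le_of_sum_range_le fun n => le_trans ?_ (ENNReal.sum_le_tsum (Finset.range n))
  have h := sum_mul_le_sum_mul_of_partial_sums_le (z := fun i => (a i : ℝ) ^ (p - 1))
    (a := fun i => (a i : ℝ)) (b := fun i => (b i : ℝ))
    (fun i j h => Real.rpow_le_rpow (a j).coe_nonneg (by exact_mod_cast ha' h) (by linarith))
    (fun i => Real.rpow_nonneg (a i).coe_nonneg _) (fun n => by exact_mod_cast hab n) n
  have e : ∀ i, (a i : ℝ) ^ (p - 1) * a i = (a i : ℝ) ^ p := fun i => by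
    rw [← Real.rpow_add_one' (a i).coe_nonneg (by linarith), sub_add_cancel]
  simp only [e] at h
  have hy := Finset.sum_le_sum fun i (_ : i ∈ Finset.range n) =>
    Real.mul_rpow_sub_one_mul_le hp (a i).coe_nonneg (b i).coe_nonneg
  rw [← Finset.mul_sum, Finset.sum_add_distrib, ← Finset.mul_sum] at hy
  have hs : ∑ i ∈ Finset.range n, (a i : ℝ) ^ p ≤ ∑ i ∈ Finset.range n, (b i : ℝ) ^ p := by
    have := mul_le_mul_of_nonneg_left h (by linarith : 0 ≤ p)
    linarith
  simp only [← ENNReal.coe_rpow_of_nonneg _ (by linarith : 0 ≤ p)]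
  exact_mod_cast hs

/-- Insertion of `a` into an antitone sequence, keeping it antitone. -/
def antitoneInsert {α : Type*} [LinearOrder α] (a : α) (y : ℕ → α) : ℕ → α
  | 0 => max a (y 0)
  | k + 1 => max (min a (y k)) (y (k + 1))

/-- The antitone arrangement of `x 0, …, x (n - 1)`, followed by zeros. -/
noncomputable def antitoneInitial (x : ℕ → ℝ≥0∞) : ℕ → ℕ → ℝ≥0∞
  | 0 => 0
  | n + 1 => antitoneInsert (x n) (antitoneInitial x n)

theorem le_antitoneInsert {α : Type*} [LinearOrder α] (a : α) (y : ℕ → α) :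
    y ≤ antitoneInsert a y := by
  rintro (_ | k) <;> simp [antitoneInsert]

theorem Antitone.antitoneInsert {α : Type*} [LinearOrder α] {y : ℕ → α} (hy : Antitone y)
    (a : α) : Antitone (antitoneInsert a y) := by
  refine antitone_nat_of_succ_le ?_
  rintro (_ | k)
  · simp only [_root_.antitoneInsert]
    exact max_le_max (min_le_left _ _) (hy (Nat.zero_le _))
  · simp only [_root_.antitoneInsert]
    exact max_le (le_max_of_le_right (min_le_right _ _)) (le_max_of_le_right (hy (Nat.le_succ _)))

theorem sum_antitoneInsert {α β : Type*} [LinearOrder α] [AddCommMonoid β] {y : ℕ → α}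
    (hy : Antitone y) (a : α) (f : α → β) (m : ℕ) :
    ∑ i ∈ Finset.range (m + 1), f (antitoneInsert a y i) + f (min a (y m)) =
      ∑ i ∈ Finset.range (m + 1), f (y i) + f a := by
  have hmm : ∀ u v, f (max u v) + f (min u v) = f u + f v := fun u v => by
    rcases le_total u v with h | h <;> simp [h, add_comm]
  induction m with
  | zero => simp [antitoneInsert, hmm, add_comm]
  | succ m ih =>
    have h := hmm (min a (y m)) (y (m + 1))
    rw [min_assoc, min_eq_right (hy m.le_succ)] at h
    rw [Finset.sum_range_succ, Finset.sum_range_succ _ (m + 1)]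
    simp only [Nat.succ_eq_add_one] at h
    rw [show antitoneInsert a y (m + 1) = max (min a (y m)) (y (m + 1)) from rfl,
      add_assoc, h, ← add_assoc, ih, add_right_comm]

theorem antitone_antitoneInitial (x : ℕ → ℝ≥0∞) (n : ℕ) : Antitone (antitoneInitial x n) := by
  induction n with
  | zero => exact antitone_const
  | succ n ih => exact ih.antitoneInsert _

theorem antitoneInitial_eq_zero (x : ℕ → ℝ≥0∞) {n k : ℕ} (h : n ≤ k) :
    antitoneInitial x n k = 0 := by
  induction n generalizing k with
  | zero => rfl
  | succ n ih =>
    obtain ⟨k, rfl⟩ : ∃ l, k = l + 1 := ⟨k - 1, by omega⟩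
    simp [antitoneInitial, antitoneInsert, ih (show n ≤ k by omega), ih (show n ≤ k + 1 by omega)]

theorem monotone_antitoneInitial (x : ℕ → ℝ≥0∞) : Monotone (antitoneInitial x) :=
  monotone_nat_of_le_succ fun _ => le_antitoneInsert _ _

theorem sum_antitoneInitial (x : ℕ → ℝ≥0∞) {f : ℝ≥0∞ → ℝ≥0∞} (hf : f 0 = 0) (n : ℕ) :
    ∑ i ∈ Finset.range n, f (antitoneInitial x n i) = ∑ i ∈ Finset.range n, f (x i) := by
  induction n with
  | zero => simp
  | succ n ih =>
    have h := sum_antitoneInsert (antitone_antitoneInitial x n) (x n) f n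
    rw [antitoneInitial_eq_zero x le_rfl, min_eq_right zero_le, hf, add_zero,
      Finset.sum_range_succ (fun i => f (antitoneInitial x n i)), ih,
      antitoneInitial_eq_zero x le_rfl, hf, add_zero] at h
    rw [Finset.sum_range_succ (fun i => f (x i)), ← h]
    rfl

/-- Every nonnegative sequence in `ℓ_p` has an antitone rearrangement with the same `ℓ_p`-sum,
whose partial sums dominate those of the sequence. -/
theorem exists_antitone_tsum_rpow_eq {p : ℝ} (hp : 0 < p) (x : ℕ → ℝ≥0∞)
    (hx : ∑' k, x k ^ p < ⊤) :
    ∃ y : ℕ → ℝ≥0∞, (∀ k, y k ≠ ⊤) ∧ Antitone y ∧ ∑' k, y k ^ p = ∑' k, x k ^ p ∧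
      ∀ n, ∑ i ∈ Finset.range n, x i ≤ ∑ i ∈ Finset.range n, y i := by
  set y : ℕ → ℝ≥0∞ := fun k => ⨆ n, antitoneInitial x n k
  have hle : ∀ n k, antitoneInitial x n k ≤ y k := fun n k =>
    le_iSup (fun n => antitoneInitial x n k) n
  have hsum : ∑' k, y k ^ p = ∑' k, x k ^ p := by
    refine le_antisymm (ENNReal.tsum_le_of_sum_range_le fun m => ?_)
      (ENNReal.tsum_le_of_sum_range_le fun n => ?_)
    · have e : ∀ k, y k ^ p = ⨆ n, antitoneInitial x n k ^ p := fun k =>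
        (ENNReal.orderIsoRpow p hp).map_iSup _
      simp only [e]
      rw [ENNReal.finsetSum_iSup_of_monotone fun k i j h =>
        ENNReal.rpow_le_rpow (monotone_antitoneInitial x h k) hp.le]
      refine iSup_le fun n => ?_
      calc ∑ k ∈ Finset.range m, antitoneInitial x n k ^ p
          ≤ ∑ k ∈ Finset.range (max m n), antitoneInitial x (max m n) k ^ p :=
            (Finset.sum_le_sum_of_subset (Finset.range_mono (le_max_left m n))).trans
              (Finset.sum_le_sum fun k _ =>
                ENNReal.rpow_le_rpow (monotone_antitoneInitial x (le_max_right m n) k) hp.le)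
        _ = ∑ k ∈ Finset.range (max m n), x k ^ p :=
            sum_antitoneInitial x (f := (· ^ p)) (ENNReal.zero_rpow_of_pos hp) _
        _ ≤ ∑' k, x k ^ p := ENNReal.sum_le_tsum _
    · rw [← sum_antitoneInitial x (f := (· ^ p)) (ENNReal.zero_rpow_of_pos hp) n]
      exact (Finset.sum_le_sum fun k _ => ENNReal.rpow_le_rpow (hle n k) hp.le).trans
        (ENNReal.sum_le_tsum _)
  refine ⟨y, fun k hk => ?_, fun i j h => iSup_mono fun n => antitone_antitoneInitial x n h, hsum,
    fun n => ?_⟩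
  · have := (ENNReal.le_tsum k).trans_lt (hsum ▸ hx)
    simp [hk, hp] at this
  · refine (sum_antitoneInitial x (f := id) rfl n).symm.trans_le ?_
    exact Finset.sum_le_sum fun k _ => hle n k

section Norlund

variable {w : ℕ → ℝ}

theorem norlundMatrix_nonneg (hw : ∀ n, 0 < w n) (j k : ℕ) : 0 ≤ norlundMatrix w j k := by
  unfold norlundMatrix
  split_ifs
  · exact div_nonneg (hw _).le (Finset.sum_nonneg fun i _ => (hw i).le)
  · exact le_rfl

theorem antitone_norlundMatrix_row (hw : ∀ n, 0 < w n) (hwm : Monotone w) (j : ℕ) :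
    Antitone (norlundMatrix w j) := by
  intro k l hkl
  by_cases hl : l ≤ j
  · simp only [norlundMatrix, hl, hkl.trans hl, if_true]
    exact div_le_div_of_nonneg_right (hwm (Nat.sub_le_sub_left hkl j))
      (Finset.sum_nonneg fun i _ => (hw i).le)
  · simpa [norlundMatrix, hl] using norlundMatrix_nonneg hw j k

theorem sum_norlundMatrix_row (hw : ∀ n, 0 < w n) (j r : ℕ) :
    ∑ k ∈ Finset.range r, norlundMatrix w j k =
      1 - (∑ i ∈ Finset.range (j + 1 - r), w i) / ∑ i ∈ Finset.range (j + 1), w i := by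
  have hW : 0 < ∑ i ∈ Finset.range (j + 1), w i := Finset.sum_pos (fun i _ => hw i) (by simp)
  induction r with
  | zero => simp [hW.ne']
  | succ r ih =>
    rw [Finset.sum_range_succ, ih]
    by_cases h : r ≤ j
    · have e : j + 1 - r = (j - r) + 1 := by omega
      have e' : j + 1 - (r + 1) = j - r := by omega
      rw [e, e', Finset.sum_range_succ _ (j - r)]
      simp only [norlundMatrix, h, if_true]
      ring
    · have e : j + 1 - r = 0 := by omega
      have e' : j + 1 - (r + 1) = 0 := by omega
      simp [norlundMatrix, h, e, e']

theorem mul_add_le_add_mul_of_ratio_antitone (hw : ∀ n, 0 < w n)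
    (hratio : ∀ n : ℕ, w (n + 2) / w (n + 1) ≤ w (n + 1) / w n) {i m : ℕ} (him : i ≤ m) (r : ℕ) :
    w i * w (m + r) ≤ w (i + r) * w m := by
  have hq : Antitone fun n => w (n + 1) / w n := antitone_nat_of_succ_le hratio
  have hr : Antitone fun n => w (n + r) / w n := by
    refine antitone_nat_of_succ_le fun n => ?_
    have h : w (n + r + 1) / w (n + r) ≤ w (n + 1) / w n := hq (Nat.le_add_right n r)
    rw [div_le_div_iff₀ (hw _) (hw _)] at h
    rw [div_le_div_iff₀ (hw _) (hw _), show n + 1 + r = n + r + 1 by ring]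
    linarith
  have h := hr him
  simp only at h
  rw [div_le_div_iff₀ (hw _) (hw _)] at h
  linarith

theorem antitone_sum_norlundMatrix_row (hw : ∀ n, 0 < w n)
    (hratio : ∀ n : ℕ, w (n + 2) / w (n + 1) ≤ w (n + 1) / w n) (r : ℕ) :
    Antitone fun j => ∑ k ∈ Finset.range r, norlundMatrix w j k := by
  refine antitone_nat_of_succ_le fun j => ?_
  have hW : ∀ j, 0 < ∑ i ∈ Finset.range (j + 1), w i := fun j =>
    Finset.sum_pos (fun i _ => hw i) (by simp)
  simp only [sum_norlundMatrix_row hw]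
  refine sub_le_sub_left ?_ 1
  rcases le_total (j + 1) r with h | h
  · rw [Nat.sub_eq_zero_of_le h]
    simpa using div_nonneg (Finset.sum_nonneg fun i _ => (hw i).le) (hW (j + 1)).le
  · obtain ⟨m, hm⟩ := Nat.exists_eq_add_of_le' h
    have hWm : 0 ≤ ∑ i ∈ Finset.range m, w i := Finset.sum_nonneg fun i _ => (hw i).le
    rw [div_le_div_iff₀ (hW _) (hW _), Finset.sum_range_succ _ (j + 1),
      show j + 1 + 1 - r = m + 1 by omega, show j + 1 - r = m by omega, hm,
      Finset.sum_range_succ _ m]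
    have h1 : (∑ i ∈ Finset.range m, w i) * w (m + r) ≤
        (∑ i ∈ Finset.range m, w (r + i)) * w m := by
      rw [Finset.sum_mul, Finset.sum_mul]
      refine Finset.sum_le_sum fun i hi => ?_
      rw [add_comm r i]
      exact mul_add_le_add_mul_of_ratio_antitone hw hratio (Finset.mem_range.1 hi).le r
    have h2 : ∑ i ∈ Finset.range m, w (r + i) ≤ ∑ i ∈ Finset.range (m + r), w i := by
      rw [add_comm m r, Finset.sum_range_add]
      exact le_add_of_nonneg_left (Finset.sum_nonneg fun i _ => (hw i).le)
    have h3 := mul_le_mul_of_nonneg_right h2 (hw m).le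
    linarith

end Norlund

theorem mulVec_eq_tsum_mul {A : ℕ → ℕ → ℝ} (hA : ∀ j k, 0 ≤ A j k) (x : ℕ → ℝ) (j : ℕ) :
    mulVec A x j = ∑' k, ENNReal.ofReal (A j k) * ENNReal.ofReal (x k) := by
  simp only [mulVec, ENNReal.ofReal_mul (hA _ _)]

/-- It suffices to compare `A x` with `A y` for antitone `y` whose partial sums dominate those
of `x`. -/
theorem DetByDecr.of_partial_sums_le {p : ℝ} (hp : 0 < p) {A : ℕ → ℕ → ℝ}
    (h : ∀ x y : ℕ → ℝ,
      (∀ n, ∑ i ∈ Finset.range n, ENNReal.ofReal (x i) ≤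
        ∑ i ∈ Finset.range n, ENNReal.ofReal (y i)) →
      ∑' j, mulVec A x j ^ p ≤ ∑' j, mulVec A y j ^ p) :
    DetByDecr p A := by
  intro x _ hx
  obtain ⟨y, hy_top, hy, hsum, hxy⟩ :=
    exists_antitone_tsum_rpow_eq hp (fun k => ENNReal.ofReal (x k)) hx
  refine ⟨fun k => (y k).toReal, fun k => ENNReal.toReal_nonneg,
    fun i j hij => ENNReal.toReal_mono (hy_top i) (hy hij), ?_, h x _ ?_⟩
  · simpa only [ENNReal.ofReal_toReal (hy_top _)] using hsum
  · simpa only [ENNReal.ofReal_toReal (hy_top _)] using hxy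

/-- Corollary 4.3(ii) for `E = F = ℓ_p`: if `w` is nondecreasing with `w_1 > 0` and
`w_{n+1}/w_n ≤ w_n/w_{n-1}` for all `n ≥ 2`, then the `ℓ_p`-norm of the transpose
`T = (A_W^{NM})ᵗ` of the Nörlund mean matrix is determined by decreasing sequences,
and the same holds for `A_W^{NM}` itself. -/
theorem lp_norm_determined_by_decreasing_norlund_transpose
    (p : ℝ) (hp : 1 ≤ p)
    (w : ℕ → ℝ) (hw0 : 0 < w 0) (hwm : Monotone w)
    (hratio : ∀ n : ℕ, w (n + 2) / w (n + 1) ≤ w (n + 1) / w n) :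
    DetByDecr p (fun j k => norlundMatrix w k j) ∧
      DetByDecr p (norlundMatrix w) := by
  have hp0 : 0 < p := zero_lt_one.trans_le hp
  have hw : ∀ n, 0 < w n := fun n => hw0.trans_le (hwm n.zero_le)
  have hA := norlundMatrix_nonneg hw
  refine ⟨.of_partial_sums_le hp0 fun x y hxy => ?_, .of_partial_sums_le hp0 fun x y hxy => ?_⟩
  · have hanti : ∀ x, Antitone (mulVec (fun j k => norlundMatrix w k j) x) := fun x i j hij => by
      rw [mulVec_eq_tsum_mul fun j k => hA k j, mulVec_eq_tsum_mul fun j k => hA k j]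
      exact ENNReal.tsum_le_tsum fun k => mul_le_mul_left
        (ENNReal.ofReal_le_ofReal (antitone_norlundMatrix_row hw hwm k hij)) _
    have hpartial : ∀ n, ∑ j ∈ Finset.range n, mulVec (fun j k => norlundMatrix w k j) x j ≤
        ∑ j ∈ Finset.range n, mulVec (fun j k => norlundMatrix w k j) y j := fun n => by
      have e : ∀ x : ℕ → ℝ, ∑ j ∈ Finset.range n, mulVec (fun j k => norlundMatrix w k j) x j =
          ∑' k, ENNReal.ofReal (∑ j ∈ Finset.range n, norlundMatrix w k j) *
            ENNReal.ofReal (x k) := fun x => by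
        simp only [mulVec_eq_tsum_mul fun j k => hA k j]
        rw [← Summable.tsum_finsetSum fun _ _ => ENNReal.summable]
        simp only [ENNReal.ofReal_sum_of_nonneg fun j _ => hA _ j, Finset.sum_mul]
      rw [e, e]
      exact ENNReal.tsum_mul_le_tsum_mul_of_partial_sums_le
        (fun i j hij => ENNReal.ofReal_le_ofReal (antitone_sum_norlundMatrix_row hw hratio n hij))
        (by simp) (by simp) (by simp) hxy
    by_cases hy : mulVec (fun j k => norlundMatrix w k j) y 0 = ⊤
    · have h := ENNReal.le_tsum (f := fun j => mulVec (fun j k => norlundMatrix w k j) y j ^ p) 0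
      simp only [hy, ENNReal.top_rpow_of_pos hp0, top_le_iff] at h
      exact h ▸ le_top
    · have hx : mulVec (fun j k => norlundMatrix w k j) x 0 ≠ ⊤ :=
        ne_top_of_le_ne_top hy (by simpa using hpartial 1)
      exact ENNReal.tsum_rpow_le_of_partial_sums_le hp (hanti x)
        (fun j => ne_top_of_le_ne_top hx (hanti x j.zero_le))
        (fun j => ne_top_of_le_ne_top hy (hanti y j.zero_le)) hpartial
  · refine ENNReal.tsum_le_tsum fun j => ENNReal.rpow_le_rpow ?_ hp0.le
    rw [mulVec_eq_tsum_mul hA, mulVec_eq_tsum_mul hA]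
    exact ENNReal.tsum_mul_le_tsum_mul_of_partial_sums_le
      (fun i k hik => ENNReal.ofReal_le_ofReal (antitone_norlundMatrix_row hw hwm j hik))
      (by simp) (by simp) (by simp) hxy
end

section
/- Let n ≥ 1 and let (v_k)_{k=1}^n and (u_k)_{k=1}^n be nonnegative real sequences such that ∑_{k=1}^r v_k ≥ ∑_{k∈N} u_k for every 1 ≤ r ≤ n and every subset N ⊆ {1,…,n} with |N| = r. Then for every nonnegative sequence (x_k)_{k=1}^n and every permutation σ of {1,…,n} such that k ↦ x_{σ(k)} is decreasing, one has ∑_{k=1}^n v_k x_{σ(k)} ≥ ∑_{k=1}^n u_k x_k. -/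
/-- If all initial partial sums of `d` are nonnegative and `y` is decreasing, then
`(∑ d) * y_last ≤ ∑ d * y`. -/
theorem sum_mul_last_le_sum_mul_of_antitone (m : ℕ) (d y : Fin (m + 1) → ℝ)
    (hd : ∀ r ≤ m, 0 ≤ ∑ k : Fin (m + 1), if (k : ℕ) < r then d k else 0) (hy : Antitone y) :
    (∑ k, d k) * y (Fin.last m) ≤ ∑ k, d k * y k := by
  induction m with
  | zero => simp
  | succ m ih =>
    have restrict : ∀ r ≤ m + 1,
        0 ≤ ∑ k : Fin (m + 1), if (k : ℕ) < r then d k.castSucc else 0 := by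
      intro r hr
      have := hd r hr
      rw [Fin.sum_univ_castSucc] at this
      simpa [Nat.not_lt.mpr hr] using this
    have hih := ih (fun k => d k.castSucc) (fun k => y k.castSucc)
      (fun r hr => restrict r (by omega)) (fun a b hab => hy (by simpa using hab))
    have hsum : 0 ≤ ∑ k : Fin (m + 1), d k.castSucc := by
      simpa only [Fin.is_lt, if_true] using restrict (m + 1) le_rfl
    have hlast : y (Fin.last (m + 1)) ≤ y (Fin.last m).castSucc := hy (Fin.le_last _)
    rw [Fin.sum_univ_castSucc d, Fin.sum_univ_castSucc fun k => d k * y k, add_mul]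
    have := mul_le_mul_of_nonneg_left hlast hsum
    linarith

/-- If all partial sums of `d` are nonnegative and `y` is decreasing and nonnegative, then
`∑ d * y` is nonnegative. -/
theorem sum_mul_nonneg_of_partial_sums_nonneg (n : ℕ) (d y : Fin n → ℝ)
    (hd : ∀ r ≤ n, 0 ≤ ∑ k : Fin n, if (k : ℕ) < r then d k else 0) (hy : Antitone y)
    (hy0 : ∀ k, 0 ≤ y k) : 0 ≤ ∑ k, d k * y k := by
  cases n with
  | zero => simp
  | succ m =>
    refine le_trans (mul_nonneg ?_ (hy0 (Fin.last m)))
      (sum_mul_last_le_sum_mul_of_antitone m d y (fun r hr => hd r (by omega)) hy)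
    simpa only [Fin.is_lt, if_true] using hd (m + 1) le_rfl


/-- Lemma 3.1: if `(v_k)_{k=1}^n`, `(u_k)_{k=1}^n` are nonnegative and
`∑_{k=1}^r v_k ≥ ∑_{k∈N} u_k` for every `1 ≤ r ≤ n` and every `N ⊆ {1,…,n}` with
`|N| = r`, then `∑_{k=1}^n v_k x_k^* ≥ ∑_{k=1}^n u_k x_k` for every nonnegative
`(x_k)_{k=1}^n`, where `x^*` is any decreasing rearrangement `k ↦ x_{σ(k)}` of `x`. -/
theorem sum_mul_decreasing_rearrangement_ge
    (n : ℕ) (hn : 1 ≤ n) (v u : Fin n → ℝ)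
    (hv : ∀ k, 0 ≤ v k) (hu : ∀ k, 0 ≤ u k)
    (h : ∀ r : ℕ, 1 ≤ r → r ≤ n → ∀ N : Finset (Fin n), N.card = r →
      ∑ k ∈ N, u k ≤ ∑ k ∈ Finset.univ.filter (fun j : Fin n => (j : ℕ) < r), v k)
    (x : Fin n → ℝ) (hx : ∀ k, 0 ≤ x k)
    (σ : Equiv.Perm (Fin n)) (hσ : Antitone fun k => x (σ k)) :
    ∑ k, u k * x k ≤ ∑ k, v k * x (σ k) := by
  rw [← Equiv.sum_comp σ (fun k => u k * x k), ← sub_nonneg, ← Finset.sum_sub_distrib]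
  simp only [← sub_mul]
  refine sum_mul_nonneg_of_partial_sums_nonneg n (fun k => v k - u (σ k)) _ (fun r hr => ?_) hσ
    (fun k => hx _)
  rw [← Finset.sum_filter, Finset.sum_sub_distrib, sub_nonneg]
  rcases Nat.eq_zero_or_pos r with rfl | hr0
  · simp
  · have hcard : (Finset.univ.filter fun j : Fin n => (j : ℕ) < r).card = r := by
      simp [Fin.card_filter_val_lt, hr]
    simpa using h r hr0 hr
      ((Finset.univ.filter fun j : Fin n => (j : ℕ) < r).map σ.toEmbedding) (by simpa using hcard)
end

section
/- Let A = (a_{j,k})_{j,k≥1} be the summability matrix with a_{1,1} = 1, a_{2,2} = 1, a_{3,2} = a_{3,3} = 1/2, a_{j,j} = 1 for all j ≥ 4, and all other entries 0. Then: (a) for e₂ the sequence with second term 1 and all other terms 0, ∑_{j=1}^∞ (Ae₂)_j = 3/2, while ∑_{j=1}^∞ (Ax)_j ≤ (3/2) ∑_{k=1}^∞ x_k for every nonnegative sequence x (so the ℓ_1 operator norm of A equals 3/2); (b) for every nonnegative antitone sequence x, ∑_{j=1}^∞ (Ax)_j ≤ (5/4) ∑_{k=1}^∞ x_k. Consequently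 the ℓ_1-norm of A is not determined by decreasing sequences, even though A is a summability matrix whose rows are increasing in the triangular sense (a_{j,k} ≤ a_{j,k+1} for j > k). -/
open scoped ENNReal

/-- The counterexample matrix of §4 (0-based indexing): `a_{1,1} = a_{2,2} = 1`,
`a_{3,2} = a_{3,3} = 1/2`, `a_{j,j} = 1` for `j ≥ 4`, all other entries `0`. -/
noncomputable def exMatrix : ℕ → ℕ → ℝ := fun j k =>
  if j = 2 then (if k = 1 ∨ k = 2 then 1 / 2 else 0)
  else if k = j then 1 else 0

theorem exMatrix_two (k : ℕ) : exMatrix 2 k = if k = 1 ∨ k = 2 then 1 / 2 else 0 := by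
  simp [exMatrix]

theorem exMatrix_of_ne_two {j : ℕ} (hj : j ≠ 2) (k : ℕ) :
    exMatrix j k = if k = j then 1 else 0 := by
  simp [exMatrix, hj]

theorem mulVec_exMatrix_of_ne_two (x : ℕ → ℝ) {j : ℕ} (hj : j ≠ 2) :
    mulVec exMatrix x j = ENNReal.ofReal (x j) := by
  rw [mulVec, tsum_eq_single j]
  · simp [exMatrix_of_ne_two hj]
  · intro k hk
    simp [exMatrix_of_ne_two hj, hk]

theorem mulVec_exMatrix_two {x : ℕ → ℝ} (hx : ∀ k, 0 ≤ x k) :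
    mulVec exMatrix x 2 = ENNReal.ofReal ((x 1 + x 2) / 2) := by
  rw [mulVec, tsum_eq_sum (s := {1, 2}), Finset.sum_pair (by norm_num),
    ← ENNReal.ofReal_add]
  · congr 1
    simp [exMatrix_two]
    ring
  · simpa [exMatrix_two] using hx 1
  · simpa [exMatrix_two] using hx 2
  · intro k hk
    have : ¬(k = 1 ∨ k = 2) := by simpa using hk
    simp [exMatrix_two, this]

theorem tsum_ofReal_eq_add_tsum_add_three {x : ℕ → ℝ} (hx : ∀ k, 0 ≤ x k) :
    ∑' k, ENNReal.ofReal (x k) =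
      ENNReal.ofReal (x 0 + x 1 + x 2) + ∑' k, ENNReal.ofReal (x (k + 3)) := by
  rw [← ENNReal.summable.sum_add_tsum_nat_add' (f := fun k => ENNReal.ofReal (x k)) (k := 3),
    ENNReal.ofReal_add (add_nonneg (hx 0) (hx 1)) (hx 2), ENNReal.ofReal_add (hx 0) (hx 1)]
  simp [Finset.sum_range_succ]

theorem tsum_mulVec_exMatrix {x : ℕ → ℝ} (hx : ∀ k, 0 ≤ x k) :
    ∑' j, mulVec exMatrix x j =
      ENNReal.ofReal (x 0 + x 1 + (x 1 + x 2) / 2) + ∑' k, ENNReal.ofReal (x (k + 3)) := by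
  have h0 := hx 0
  have h1 := hx 1
  have h2 := hx 2
  have htail : ∑' k, mulVec exMatrix x (k + 3) = ∑' k, ENNReal.ofReal (x (k + 3)) :=
    tsum_congr fun k => mulVec_exMatrix_of_ne_two x (by omega)
  rw [← ENNReal.summable.sum_add_tsum_nat_add' (f := mulVec exMatrix x) (k := 3), htail,
    ENNReal.ofReal_add (add_nonneg h0 h1) (by positivity), ENNReal.ofReal_add h0 h1]
  simp [Finset.sum_range_succ, mulVec_exMatrix_two hx, mulVec_exMatrix_of_ne_two]

theorem tsum_mulVec_exMatrix_le {x : ℕ → ℝ} (hx : ∀ k, 0 ≤ x k) {c : ℝ} (hc : 1 ≤ c)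
    (h : x 0 + x 1 + (x 1 + x 2) / 2 ≤ c * (x 0 + x 1 + x 2)) :
    ∑' j, mulVec exMatrix x j ≤ ENNReal.ofReal c * ∑' k, ENNReal.ofReal (x k) := by
  rw [tsum_mulVec_exMatrix hx, tsum_ofReal_eq_add_tsum_add_three hx, mul_add,
    ← ENNReal.ofReal_mul (by linarith)]
  gcongr
  exact le_mul_of_one_le_left' (by simpa using hc)

/-- The counterexample after Corollary 4.5: `exMatrix` is a summability matrix whose rows
are increasing in the triangular sense, its `ℓ_1`-operator norm is `3/2` (attained at `e₂`),
yet `‖Ax‖_1 ≤ (5/4)‖x‖_1` for every nonnegative decreasing `x`; so its `ℓ_1`-norm is not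
determined by decreasing sequences. -/
theorem summability_counterexample_l1 :
    (∀ j k, j < k → exMatrix j k = 0) ∧
    (∀ j, ∑' k, exMatrix j k = 1) ∧
    (∀ j k, k < j → exMatrix j k ≤ exMatrix j (k + 1)) ∧
    (∑' j, mulVec exMatrix (fun k => if k = 1 then (1 : ℝ) else 0) j) = 3 / 2 ∧
    (∀ x : ℕ → ℝ, (∀ k, 0 ≤ x k) →
      (∑' j, mulVec exMatrix x j) ≤ 3 / 2 * ∑' k, ENNReal.ofReal (x k)) ∧
    (∀ x : ℕ → ℝ, (∀ k, 0 ≤ x k) → Antitone x →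
      (∑' j, mulVec exMatrix x j) ≤ 5 / 4 * ∑' k, ENNReal.ofReal (x k)) := by
  have h32 : ENNReal.ofReal (3 / 2) = 3 / 2 := by
    rw [ENNReal.ofReal_div_of_pos (by norm_num)]; simp
  have h54 : ENNReal.ofReal (5 / 4) = 5 / 4 := by
    rw [ENNReal.ofReal_div_of_pos (by norm_num)]; simp
  refine ⟨?_, ?_, ?_, ?_, ?_, ?_⟩
  · intro j k hjk
    unfold exMatrix
    split_ifs <;> first | rfl | omega
  · intro j
    by_cases hj : j = 2
    · subst hj
      rw [tsum_eq_sum (s := {1, 2}), Finset.sum_pair (by norm_num)]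
      · norm_num [exMatrix_two]
      · intro k hk
        have : ¬(k = 1 ∨ k = 2) := by simpa using hk
        simp [exMatrix_two, this]
    · simp [exMatrix_of_ne_two hj]
  · intro j k hkj
    unfold exMatrix
    split_ifs <;> first | omega | norm_num
  · rw [tsum_mulVec_exMatrix (fun k => by positivity), ← h32]
    have (i : ℕ) : i + 3 ≠ 1 := by omega
    norm_num [this]
  · intro x hx
    rw [← h32]
    exact tsum_mulVec_exMatrix_le hx (by norm_num) (by linarith [hx 0, hx 1, hx 2])
  · intro x hx hanti
    rw [← h54]
    exact tsum_mulVec_exMatrix_le hx (by norm_num)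
      (by linarith [hx 0, hx 1, hx 2, hanti zero_le_one])
end
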